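/- Let e₁,…,e₆ be the standard basis of ℝ⁶ and J ∈ M₆(ℝ) defined by Je₁=e₂, Je₂=−e₁, Je₃=e₄, Je₄=−e₃, Je₅=e₆, Je₆=−e₅. For A ∈ M₆(ℝ) set Q₁(A) := (1/2)[A,Aᵀ] + (1/12)·tr((A+Aᵀ)²)·I₆ − (1/2)(A+Aᵀ)² and q(A) := −(1/6)·tr((A+Aᵀ)²). Let A ∈ M₆(ℝ) be nonzero with AJ = JA, tr(A) = 0 and tr(AJ) = 0, and suppose there exist c ∈ ℝ and D₁ ∈ M₆(ℝ) with Q₁(A) = c·I₆ + (1/2)(D₁ + D₁ᵀ) and D₁·A − A·D₁ = (q(A) − c)·A. Then either [A,Aᵀ] = 0 or A is nilpotent; and if [A,Aᵀ] = 0 then c = q(A) and Q₁(A) commutes with A. -/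

import Mathlib

open Matrix

/-- The complex structure `J` on `ℝ⁶`: `Je₁ = e₂`, `Je₂ = -e₁`, `Je₃ = e₄`, `Je₄ = -e₃`,
`Je₅ = e₆`, `Je₆ = -e₅`. -/
noncomputable def J6 : Matrix (Fin 6) (Fin 6) ℝ :=
  !![0,-1,0,0,0,0; 1,0,0,0,0,0; 0,0,0,-1,0,0; 0,0,1,0,0,0; 0,0,0,0,0,-1; 0,0,0,0,1,0]

/-- `Q₁(A) = (1/2)[A,Aᵀ] + (1/12)tr((A+Aᵀ)²)I − (1/2)(A+Aᵀ)²`. -/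
noncomputable def Q1 (A : Matrix (Fin 6) (Fin 6) ℝ) : Matrix (Fin 6) (Fin 6) ℝ :=
  (1/2 : ℝ) • (A * Aᵀ - Aᵀ * A)
    + ((1/12 : ℝ) * ((A + Aᵀ)^2).trace) • (1 : Matrix (Fin 6) (Fin 6) ℝ)
    - (1/2 : ℝ) • (A + Aᵀ)^2

/-- `q(A) = −(1/6)tr((A+Aᵀ)²)`. -/
noncomputable def qA (A : Matrix (Fin 6) (Fin 6) ℝ) : ℝ := -(1/6) * ((A + Aᵀ)^2).trace

/-- Frobenius definiteness for real matrices. -/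
lemma frob_zero (M : Matrix (Fin 6) (Fin 6) ℝ) (h : (M * Mᵀ).trace = 0) : M = 0 := by
  have := (Matrix.trace_mul_conjTranspose_self_eq_zero_iff (A := M)).1
    (by rwa [Matrix.conjTranspose_eq_transpose_of_trivial])
  exact this

/-- A nonzero eigenvector relation `[D,A] = l A` forces `A` to be nilpotent. -/
lemma nilp_of_comm (A D : Matrix (Fin 6) (Fin 6) ℝ) (l : ℝ) (hl : l ≠ 0)
    (h : D * A - A * D = l • A) : IsNilpotent A := by
  have hk : ∀ k : ℕ, D * A ^ k - A ^ k * D = ((k : ℝ) * l) • A ^ k := by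
    intro k
    induction k with
    | zero => simp
    | succ k ih =>
      have e : D * A ^ (k+1) - A ^ (k+1) * D
          = (D * A ^ k - A ^ k * D) * A + A ^ k * (D * A - A * D) := by
        rw [pow_succ]; noncomm_ring
      rw [e, ih, h, pow_succ, smul_mul_assoc, mul_smul_comm, ← add_smul]
      push_cast; ring_nf
  by_contra hn
  have hn' : ∀ k : ℕ, A ^ k ≠ 0 := fun k hk0 => hn ⟨k, hk0⟩
  let f : Module.End ℝ (Matrix (Fin 6) (Fin 6) ℝ) :=
    LinearMap.mulLeft ℝ D - LinearMap.mulRight ℝ D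
  have hev : ∀ k : ℕ, f.HasEigenvalue ((k : ℝ) * l) := fun k =>
    Module.End.hasEigenvalue_of_hasEigenvector (x := A ^ k)
      ⟨Module.End.mem_eigenspace_iff.2 (by simpa [f] using hk k), hn' k⟩
  have hinj : Function.Injective (fun k : ℕ => (k : ℝ) * l) := by
    intro a b hab
    exact_mod_cast mul_right_cancel₀ hl hab
  exact Set.infinite_of_injective_forall_mem hinj hev (Module.End.finite_hasEigenvalue f)

/-- When `D` commutes with `A`, the symmetric part of `D` is orthogonal to `[A,Aᵀ]`. -/
lemma trace_comm (A D : Matrix (Fin 6) (Fin 6) ℝ) :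
    (D * (A * Aᵀ - Aᵀ * A)).trace = ((D * A - A * D) * Aᵀ).trace := by
  simp only [mul_sub, sub_mul, trace_sub]
  rw [← mul_assoc, ← mul_assoc, trace_mul_comm (D * Aᵀ) A, ← mul_assoc]

lemma normal_of_comm (A D : Matrix (Fin 6) (Fin 6) ℝ) (c : ℝ)
    (hQ : Q1 A = c • (1 : Matrix (Fin 6) (Fin 6) ℝ) + (1/2 : ℝ) • (D + Dᵀ))
    (hD : D * A - A * D = 0) : A * Aᵀ - Aᵀ * A = 0 := by
  set N := A * Aᵀ - Aᵀ * A with hN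
  have hNt : Nᵀ = N := by simp [hN, transpose_sub, transpose_mul]
  have t0 : N.trace = 0 := by rw [hN, trace_sub, trace_mul_comm, sub_self]
  have t1 : (D * N).trace = 0 := by rw [hN, trace_comm, hD]; simp
  have t2 : (Dᵀ * N).trace = 0 := by
    rw [← trace_transpose, transpose_mul, transpose_transpose, hNt, trace_mul_comm, t1]
  have t3 : ((A + Aᵀ)^2 * N).trace = 0 := by
    have a1 : (A * A * (A * Aᵀ)).trace = (A * A * (Aᵀ * A)).trace := by
      rw [← mul_assoc, ← mul_assoc, trace_mul_comm (A * A * Aᵀ) A]; simp only [mul_assoc]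
    have a2 : (Aᵀ * Aᵀ * (A * Aᵀ)).trace = (Aᵀ * Aᵀ * (Aᵀ * A)).trace := by
      rw [← mul_assoc, trace_mul_comm (Aᵀ * Aᵀ * A) Aᵀ]; simp only [mul_assoc]
    have a3 : (A * Aᵀ * (A * Aᵀ)).trace = (Aᵀ * A * (Aᵀ * A)).trace := by
      rw [mul_assoc, trace_mul_comm]; simp only [mul_assoc]
    have a4 : (A * Aᵀ * (Aᵀ * A)).trace = (Aᵀ * A * (A * Aᵀ)).trace := trace_mul_comm _ _
    have e : (A + Aᵀ)^2 * N = A * A * (A * Aᵀ) - A * A * (Aᵀ * A)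
        + (Aᵀ * Aᵀ * (A * Aᵀ) - Aᵀ * Aᵀ * (Aᵀ * A))
        + (A * Aᵀ * (A * Aᵀ) - A * Aᵀ * (Aᵀ * A))
        + (Aᵀ * A * (A * Aᵀ) - Aᵀ * A * (Aᵀ * A)) := by
      rw [hN]; noncomm_ring
    rw [e]; simp only [trace_add, trace_sub]
    linarith
  have key := congrArg (fun M => (M * N).trace) hQ
  simp only [Q1, ← hN, add_mul, sub_mul, smul_mul_assoc, trace_add, trace_sub, trace_smul,
    one_mul, t0, t1, t2, t3, smul_eq_mul] at key
  apply frob_zero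
  rw [hNt]; linarith

/-- If a nonzero `A ∈ sl(3,ℂ) ⊂ M₆(ℝ)` is a semi-algebraic soliton, i.e.
`Q₁(A) = cI + (1/2)(D₁+D₁ᵀ)` and `[D₁,A] = (q(A)−c)A` for some `c, D₁`, then `A`
is normal or nilpotent; and if `A` is normal then `c = q(A)` and `[Q₁(A),A] = 0`. -/
theorem stmt17 (A : Matrix (Fin 6) (Fin 6) ℝ) (hA : A ≠ 0)
    (h1 : A * J6 = J6 * A) (h2 : A.trace = 0) (h3 : (A * J6).trace = 0)
    (c : ℝ) (D₁ : Matrix (Fin 6) (Fin 6) ℝ)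
    (hQ : Q1 A = c • (1 : Matrix (Fin 6) (Fin 6) ℝ) + (1/2 : ℝ) • (D₁ + D₁ᵀ))
    (hD : D₁ * A - A * D₁ = (qA A - c) • A) :
    (A * Aᵀ - Aᵀ * A = 0 ∨ IsNilpotent A) ∧
    (A * Aᵀ - Aᵀ * A = 0 → c = qA A ∧ Q1 A * A = A * Q1 A) := by
  have hl : A * Aᵀ - Aᵀ * A = 0 → c = qA A := by
    intro hN
    by_contra hne
    have := trace_comm A D₁
    rw [hN, hD, smul_mul_assoc, trace_smul, mul_zero, trace_zero, smul_eq_mul] at this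
    rcases mul_eq_zero.1 this.symm with h | h
    · exact hne (by linarith)
    · exact hA (frob_zero A h)
  refine ⟨?_, fun hN => ⟨hl hN, ?_⟩⟩
  · by_cases hc : qA A - c = 0
    · left
      exact normal_of_comm A D₁ c hQ (by rw [hD, hc, zero_smul])
    · right
      exact nilp_of_comm A D₁ _ hc hD
  · have hS : Commute ((A + Aᵀ)^2) A := by
      apply Commute.pow_left
      exact (Commute.refl A).add_left (sub_eq_zero.1 hN).symm
    unfold Q1
    rw [hN]
    simp only [smul_zero, zero_add, sub_mul, mul_sub, smul_mul_assoc, mul_smul_comm, one_mul,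
      mul_one, hS.eq]
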